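/- arXiv:math/0104120 — 2 statements merged into one kernel-verified Lean document; each statement's English description precedes it below -/
import Mathlib

section
/- Let S be a subset of ℝⁿ. For a positive integer m, let Δ_m S denote the set of vectors (1/m)·(λ_1 x_1 + ⋯ + λ_m x_m) with |λ_k| ≤ 1 and x_k ∈ S. If 1/3 < θ < 1, then Γ_θ(Δ_m S) ⊆ (2θ/(3θ-1)) · Γ_{θ^(1/m)} S. -/
open Pointwise

/-- The `θ`-geometric hull of a set `S`. -/
def geomHull {E : Type*} [NormedAddCommGroup E] [NormedSpace ℝ E]
    (θ : ℝ) (S : Set E) : Set E :=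
  {y | ∃ (c : ℕ → ℝ) (x : ℕ → E), (∀ k, |c k| ≤ θ ^ k) ∧ (∀ k, x k ∈ S) ∧
    HasSum (fun k => ((1 - θ) * c k) • x k) y}

/-- `Δ_m S`: the set of averages `(1/m) • ∑ₖ λₖ • xₖ` with `|λₖ| ≤ 1`, `xₖ ∈ S`. -/
def deltaM {E : Type*} [NormedAddCommGroup E] [NormedSpace ℝ E]
    (m : ℕ) (S : Set E) : Set E :=
  {y | ∃ (c : Fin m → ℝ) (x : Fin m → E), (∀ k, |c k| ≤ 1) ∧ (∀ k, x k ∈ S) ∧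
    y = (m : ℝ)⁻¹ • ∑ k, c k • x k}

lemma aux_correct {E : Type*} [NormedAddCommGroup E] [NormedSpace ℝ E] [FiniteDimensional ℝ E]
    (x : ℕ → E) (e B : ℕ → ℝ) (h : ∀ i, |e i| < B i) (y : E) (m : ℕ)
    (hy : Filter.Tendsto (fun K : ℕ => ∑ i ∈ Finset.range (K * m), e i • x i) Filter.atTop
      (nhds y)) :
    ∃ e' : ℕ → ℝ, (∀ i, |e' i| ≤ B i) ∧ HasSum (fun i => e' i • x i) y := by
  classical
  set U : Submodule ℝ E := Submodule.span ℝ (Set.range x) with hU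
  have hmem : ∀ K : ℕ, ∑ i ∈ Finset.range (K * m), e i • x i ∈ U := fun K =>
    Submodule.sum_mem _ fun i _ => Submodule.smul_mem _ _ (Submodule.subset_span ⟨i, rfl⟩)
  have hyU : y ∈ U := by
    have hc : IsClosed (U : Set E) := U.closed_of_finiteDimensional
    exact hc.mem_of_tendsto hy (Filter.Eventually.of_forall hmem)
  let r : ℕ → U := fun K => ⟨y, hyU⟩ - ⟨_, hmem K⟩
  have hr : Filter.Tendsto r Filter.atTop (nhds 0) := by
    rw [tendsto_subtype_rng]
    simpa [r] using (tendsto_const_nhds (x := y)).sub hy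
  let b := Module.finBasis ℝ U
  have hl : ∀ i, ∃ l : ℕ →₀ ℝ, Finsupp.linearCombination ℝ x l = (b i : E) := by
    intro i
    have h0 : ((b i : U) : E) ∈ Submodule.span ℝ (Set.range x) := (b i).2
    obtain ⟨l, hl⟩ := Finsupp.mem_span_range_iff_exists_finsupp.1 h0
    exact ⟨l, by simpa [Finsupp.linearCombination_apply] using hl⟩
  choose l hl using hl
  let a : U → (ℕ →₀ ℝ) := fun v => ∑ i, b.repr v i • l i
  have ha : ∀ v, Finsupp.linearCombination ℝ x (a v) = (v : E) := by
    intro v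
    simp only [a, map_sum, map_smul, hl]
    have h0 := congrArg (Subtype.val) (b.sum_repr v)
    rw [← h0]
    simp only [Submodule.coe_sum, Submodule.coe_smul]
  let F : Finset ℕ := Finset.univ.biUnion fun i => (l i).support
  have hF : ∀ v n, n ∉ F → a v n = 0 := by
    intro v n hn
    simp only [F, Finset.mem_biUnion, Finset.mem_univ, true_and, not_exists,
      Finsupp.mem_support_iff, not_not] at hn
    simp [a, Finsupp.finsetSum_apply, hn]
  have hlim : ∀ n, Filter.Tendsto (fun K => a (r K) n) Filter.atTop (nhds 0) := by
    intro n
    have hc : Continuous (fun v : U => a v n) := by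
      simp only [a, Finsupp.finsetSum_apply, Finsupp.smul_apply, smul_eq_mul]
      refine continuous_finsetSum _ fun i _ => ?_
      refine Continuous.mul ?_ continuous_const
      exact (b.coord i).continuous_of_finiteDimensional
    have := (hc.tendsto 0).comp hr
    simpa [a, Function.comp_def] using this
  have hev : ∀ᶠ K in Filter.atTop, ∀ n ∈ F, |a (r K) n| < B n - |e n| := by
    rw [Filter.eventually_all_finset]
    intro n _
    have := (hlim n).abs
    rw [abs_zero] at this
    exact this.eventually_lt_const (by linarith [h n])
  obtain ⟨K, hK⟩ := hev.exists
  refine ⟨fun i => (if i < K * m then e i else 0) + a (r K) i, ?_, ?_⟩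
  · intro i
    have h1 : |a (r K) i| ≤ B i - |e i| := by
      by_cases hi : i ∈ F
      · exact (hK i hi).le
      · rw [hF _ _ hi, abs_zero]; linarith [h i]
    refine (abs_add_le _ _).trans ?_
    split_ifs
    · linarith
    · rw [abs_zero]; linarith [abs_nonneg (e i)]
  · have h1 : HasSum (fun i => (if i < K * m then e i else 0) • x i)
        (∑ i ∈ Finset.range (K * m), e i • x i) := by
      have := hasSum_sum_of_ne_finset_zero (L := SummationFilter.unconditional ℕ)
        (f := fun i => (if i < K * m then e i else 0) • x i)
        (s := Finset.range (K * m)) (by intro i hi; simp at hi; simp [not_lt.2 hi])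
      convert this using 1
      refine Finset.sum_congr rfl fun i hi => ?_
      simp [Finset.mem_range.1 hi]
    have h2 : HasSum (fun i => a (r K) i • x i) (r K : E) := by
      rw [← ha (r K), Finsupp.linearCombination_apply, Finsupp.sum]
      exact hasSum_sum_of_ne_finset_zero (by intro i hi; simp at hi; simp [hi])
    have h3 := h1.add h2
    simp only [← add_smul] at h3
    convert h3 using 1
    simp [r]

lemma aux_key (θ : ℝ) (m : ℕ) (hm : 0 < m) (hθ0 : 1 / 3 < θ) (hθ1 : θ < 1) (φ : ℝ)
    (hφ : φ = θ ^ (1 / (m : ℝ))) :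
    (1 - θ) * φ < m * (2 * θ / (3 * θ - 1)) * (1 - φ) * θ := by
  have hθ : 0 < θ := by linarith
  have hm' : (0 : ℝ) < m := by exact_mod_cast hm
  have hφ0 : 0 < φ := hφ ▸ Real.rpow_pos_of_pos hθ _
  have h1 : Real.log φ = Real.log θ / m := by
    rw [hφ, Real.log_rpow hθ]; ring
  have h2 : -Real.log φ ≤ φ⁻¹ - 1 := by
    rw [← Real.log_inv]; exact Real.log_le_sub_one_of_pos (by positivity)
  have hu : 0 < θ⁻¹ - 1 := by
    have := (one_lt_inv₀ hθ).2 hθ1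
    linarith
  have h3 := Real.le_log_one_add_of_nonneg hu.le
  rw [show 1 + (θ⁻¹ - 1) = θ⁻¹ by ring, Real.log_inv] at h3
  have h4 : (1 - θ) * (3 * θ - 1) / (2 * θ ^ 2) < 2 * (θ⁻¹ - 1) / (θ⁻¹ - 1 + 2) := by
    have : 2 * (θ⁻¹ - 1) / (θ⁻¹ - 1 + 2) = 2 * (1 - θ) / (1 + θ) := by
      rw [div_eq_div_iff (by linarith) (by linarith)]
      field_simp; ring
    rw [this, div_lt_div_iff₀ (by positivity) (by linarith)]
    nlinarith [pow_pos (sub_pos.2 hθ1) 3]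
  have h5 : (1 - θ) * (3 * θ - 1) / (2 * θ ^ 2) < m * (φ⁻¹ - 1) := by
    have : m * -Real.log φ = - Real.log θ := by rw [h1]; field_simp
    nlinarith
  rw [div_lt_iff₀ (by positivity)] at h5
  have h6 : m * (φ⁻¹ - 1) * (2 * θ ^ 2) = m * (1 - φ) * (2 * θ ^ 2) / φ := by field_simp
  rw [h6, lt_div_iff₀ hφ0] at h5
  have h7 : m * (2 * θ / (3 * θ - 1)) * (1 - φ) * θ
      = m * (1 - φ) * (2 * θ ^ 2) / (3 * θ - 1) := by ring
  rw [h7, lt_div_iff₀ (by linarith)]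
  linarith

theorem stmt_4 (n : ℕ) (S : Set (EuclideanSpace ℝ (Fin n))) (θ : ℝ) (m : ℕ)
    (hm : 0 < m) (hθ0 : 1 / 3 < θ) (hθ1 : θ < 1) :
    geomHull θ (deltaM m S) ⊆ (2 * θ / (3 * θ - 1)) • geomHull (θ ^ (1 / (m : ℝ))) S := by
  rintro y ⟨c, v, hc, hv, hsum⟩
  have hkey := aux_key θ m hm hθ0 hθ1 _ rfl
  have hθ : 0 < θ := by linarith
  have hm' : (0 : ℝ) < m := by exact_mod_cast hm
  have hφ0 : 0 < θ ^ (1 / (m : ℝ)) := Real.rpow_pos_of_pos hθ _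
  have hφ1 : θ ^ (1 / (m : ℝ)) < 1 := Real.rpow_lt_one hθ.le hθ1 (by positivity)
  have hφm : (θ ^ (1 / (m : ℝ))) ^ m = θ := by
    rw [one_div]; exact Real.rpow_inv_natCast_pow hθ.le hm.ne'
  have hC : 0 < 2 * θ / (3 * θ - 1) := div_pos (by linarith) (by linarith)
  generalize θ ^ (1 / (m : ℝ)) = φ at *
  generalize 2 * θ / (3 * θ - 1) = C at *
  choose d x hd hx hvx using hv
  let e : ℕ → ℝ := fun i => (1 - θ) * c (i / m) * (m : ℝ)⁻¹ * d (i / m) ⟨i % m, Nat.mod_lt _ hm⟩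
  let z : ℕ → EuclideanSpace ℝ (Fin n) := fun i => x (i / m) ⟨i % m, Nat.mod_lt _ hm⟩
  have hblock : ∀ K : ℕ, ∑ i ∈ Finset.range (K * m), e i • z i
      = ∑ k ∈ Finset.range K, ((1 - θ) * c k) • v k := by
    intro K
    induction K with
    | zero => simp
    | succ K ih =>
      rw [add_mul, one_mul, Finset.sum_range_add, ih, Finset.sum_range_succ, hvx K]
      congr 1
      rw [Finset.sum_range, smul_smul, Finset.smul_sum]
      refine Finset.sum_congr rfl fun j _ => ?_
      have h1 : (K * m + (j : ℕ)) / m = K := by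
        rw [mul_comm, Nat.mul_add_div hm, Nat.div_eq_of_lt j.2, add_zero]
      have h2 : (K * m + (j : ℕ)) % m = j := by
        rw [mul_comm, Nat.mul_add_mod, Nat.mod_eq_of_lt j.2]
      simp only [e, z, h1, h2, smul_smul]
  have hlt : ∀ i, |e i| < C * (1 - φ) * φ ^ i := by
    intro i
    have hj : i % m < m := Nat.mod_lt _ hm
    have h1 : |e i| ≤ (1 - θ) * θ ^ (i / m) * (m : ℝ)⁻¹ := by
      simp only [e, abs_mul]
      rw [abs_of_pos (sub_pos.2 hθ1), abs_of_pos (inv_pos.2 hm')]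
      calc _ ≤ (1 - θ) * θ ^ (i / m) * (m : ℝ)⁻¹ * 1 := by
            have := sub_pos.2 hθ1
            gcongr
            · exact hc _
            · exact hd _ _
        _ = _ := mul_one _
    have h2 : φ ^ i = θ ^ (i / m) * φ ^ (i % m) := by
      conv_lhs => rw [← Nat.div_add_mod i m, pow_add, pow_mul, hφm]
    have h3 : θ ≤ φ ^ (i % m) * φ := by
      rw [← pow_succ, ← hφm]
      exact pow_le_pow_of_le_one hφ0.le hφ1.le hj
    have h4 : (1 - θ) < m * C * (1 - φ) * φ ^ (i % m) := by
      have : (1 - θ) * φ < (m * C * (1 - φ) * φ ^ (i % m)) * φ := by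
        have hp : 0 < m * C * (1 - φ) := by
          have := sub_pos.2 hφ1
          positivity
        nlinarith
      exact lt_of_mul_lt_mul_right this hφ0.le
    refine h1.trans_lt ?_
    rw [h2, ← div_eq_mul_inv, div_lt_iff₀ hm']
    have hp : 0 < θ ^ (i / m) := by positivity
    nlinarith
  have ht : Filter.Tendsto (fun K : ℕ => ∑ i ∈ Finset.range (K * m), e i • z i) Filter.atTop
      (nhds y) := by
    simp only [hblock]
    exact hsum.tendsto_sum_nat
  obtain ⟨e', he', hs⟩ := aux_correct z e _ hlt y m ht
  have hφ' : 0 < 1 - φ := sub_pos.2 hφ1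
  rw [Set.mem_smul_set]
  refine ⟨C⁻¹ • y, ⟨fun i => e' i / (C * (1 - φ)), z, ?_, fun k => hx _ _, ?_⟩, ?_⟩
  · intro k
    rw [abs_div, abs_of_pos (mul_pos hC hφ'), div_le_iff₀ (mul_pos hC hφ')]
    linarith [he' k]
  · convert hs.const_smul C⁻¹ using 2 with k
    rw [smul_smul]
    congr 1
    field_simp
  · rw [smul_smul, mul_inv_cancel₀ hC.ne', one_smul]
end

section
/- Let S be a compact spanning subset of ℝⁿ, ΔS its absolutely convex hull (the unit ball of a norm on ℝⁿ), and b_N the sign-balancing constants of this norm. Suppose 1/3 < θ < 1 and m is a positive integer with Σ_{k=1}^∞ b_{2^k m} ≤ θ. Then ΔS ⊆ (2θ/((3θ−1)(1−θ))) · Γ_{θ^{1/m}} S. -/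
open Pointwise

/-- `b` is the least constant such that for any `N` vectors there are signs `ε_k = ±1`
with `ν (∑ ε_k x_k) ≤ b · N · max_k ν (x_k)`, where `ν` is a given norm function. -/
def IsLeastSignBalanceFor {E : Type*} [NormedAddCommGroup E] [NormedSpace ℝ E]
    (ν : E → ℝ) (N : ℕ) (b : ℝ) : Prop :=
  IsLeast {c : ℝ | 0 ≤ c ∧ ∀ x : Fin N → E, ∃ ε : Fin N → ℝ,
    (∀ k, ε k = 1 ∨ ε k = -1) ∧ ν (∑ k, ε k • x k) ≤ c * N * ⨆ k, ν (x k)} b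

open Filter Topology

/-- N-fold Minkowski sum. -/
def QS {E : Type*} [AddCommGroup E] (T : Set E) : ℕ → Set E
  | 0 => {0}
  | (N + 1) => QS T N + T

lemma QS_compact {E : Type*} [NormedAddCommGroup E] {T : Set E} (hT : IsCompact T) (N : ℕ) :
    IsCompact (QS T N) := by
  induction N with
  | zero => exact isCompact_singleton
  | succ N ih => exact ih.add hT

lemma QS_exists {E : Type*} [AddCommGroup E] {T : Set E} (h0 : (0 : E) ∈ T) (N : ℕ) :
    ∀ z ∈ QS T N, ∃ v : ℕ → E, (∀ i, v i ∈ T) ∧ z = ∑ i ∈ Finset.range N, v i := by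
  induction N with
  | zero =>
    intro z hz
    refine ⟨fun _ => 0, fun _ => h0, ?_⟩
    simpa [QS] using hz
  | succ N ih =>
    rintro z ⟨z', hz', t, ht, rfl⟩
    obtain ⟨v, hv, rfl⟩ := ih z' hz'
    refine ⟨fun i => if i = N then t else v i, fun i => ?_, ?_⟩
    · dsimp only
      split_ifs
      · exact ht
      · exact hv i
    · rw [Finset.sum_range_succ]
      simp only [if_true]
      congr 1
      refine Finset.sum_congr rfl fun i hi => ?_
      rw [if_neg (Finset.mem_range.1 hi).ne]

lemma QS_mono {E : Type*} [AddCommGroup E] {T : Set E} (h0 : (0 : E) ∈ T) {M N : ℕ} (h : M ≤ N) :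
    QS T M ⊆ QS T N := by
  induction N, h using Nat.le_induction with
  | base => exact subset_rfl
  | succ N _ ih => exact fun z hz => ⟨z, ih hz, 0, h0, add_zero z⟩

lemma QS_add {E : Type*} [AddCommGroup E] {T : Set E} {M N : ℕ} {z w : E}
    (hz : z ∈ QS T M) (hw : w ∈ QS T N) : z + w ∈ QS T (M + N) := by
  induction N generalizing w with
  | zero => obtain rfl : w = 0 := hw; simpa using hz
  | succ N ih =>
    obtain ⟨w', hw', t, ht, rfl⟩ := hw
    exact ⟨z + w', ih hw', t, ht, by simp [add_assoc]⟩

lemma QS_sum {E ι : Type*} [AddCommGroup E] {T : Set E} (A : Finset ι)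
    (k : ι → ℕ) (z : ι → E) (h : ∀ i ∈ A, z i ∈ QS T (k i)) :
    ∑ i ∈ A, z i ∈ QS T (∑ i ∈ A, k i) := by
  classical
  induction A using Finset.induction_on with
  | empty => simp [QS]
  | insert a A ha ih =>
    rw [Finset.sum_insert ha, Finset.sum_insert ha]
    exact QS_add (h a (by simp)) (ih fun i hi => h i (by simp [hi]))

lemma QS_one {E : Type*} [AddCommGroup E] {T : Set E} {t : E} (ht : t ∈ T) : t ∈ QS T 1 :=
  ⟨0, rfl, t, ht, zero_add t⟩

lemma QS_nsmul {E : Type*} [AddCommGroup E] {T : Set E} {t : E} (ht : t ∈ T) (k : ℕ) :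
    k • t ∈ QS T k := by
  induction k with
  | zero => simp [QS]
  | succ k ih => rw [succ_nsmul]; exact ⟨_, ih, t, ht, rfl⟩

lemma QS_subsum {E ι : Type*} [AddCommGroup E] {T : Set E} (h0 : (0 : E) ∈ T) (A : Finset ι)
    {M : ℕ} (hA : A.card ≤ M) (v : ι → E) (hv : ∀ i, v i ∈ T) : ∑ i ∈ A, v i ∈ QS T M := by
  have := QS_sum A (fun _ => 1) v (fun i _ => QS_one (hv i))
  refine QS_mono h0 ?_ this
  simpa using hA

section
variable {E : Type*} [NormedAddCommGroup E] [NormedSpace ℝ E]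

lemma nu_nonneg (ν : E → ℝ) (hνadd : ∀ x y, ν (x + y) ≤ ν x + ν y)
    (hνsmul : ∀ (a : ℝ) x, ν (a • x) = |a| * ν x) (x : E) : 0 ≤ ν x := by
  have h0 : ν 0 = 0 := by simpa using hνsmul 0 0
  have h1 : ν (-x) = ν x := by simpa using hνsmul (-1) x
  have := hνadd x (-x)
  rw [add_neg_cancel, h0, h1] at this
  linarith

lemma nu_sum (ν : E → ℝ) (hνadd : ∀ x y, ν (x + y) ≤ ν x + ν y)
    (hνsmul : ∀ (a : ℝ) x, ν (a • x) = |a| * ν x) {ι : Type*} (A : Finset ι) (v : ι → E) :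
    ν (∑ i ∈ A, v i) ≤ ∑ i ∈ A, ν (v i) := by
  classical
  have h0 : ν 0 = 0 := by simpa using hνsmul 0 0
  induction A using Finset.induction_on with
  | empty => simp [h0]
  | insert a A ha ih =>
    rw [Finset.sum_insert ha, Finset.sum_insert ha]
    linarith [hνadd (v a) (∑ i ∈ A, v i)]

lemma halving (ν : E → ℝ) (hνadd : ∀ x y, ν (x + y) ≤ ν x + ν y)
    (hνsmul : ∀ (a : ℝ) x, ν (a • x) = |a| * ν x) {T : Set E} (h0 : (0 : E) ∈ T)
    (hT : ∀ t ∈ T, ν t ≤ 1) {M : ℕ} (hM : 0 < M) {b : ℝ}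
    (hb : IsLeastSignBalanceFor ν (2 * M) b) {z : E} (hz : z ∈ QS T (2 * M)) :
    ∃ w ∈ QS T M, ν ((1 / ((2 * M : ℕ) : ℝ)) • z - (1 / (M : ℝ)) • w) ≤ b := by
  classical
  have hneg : ∀ x, ν (-x) = ν x := fun x => by simpa using hνsmul (-1) x
  obtain ⟨v, hv, rfl⟩ := QS_exists h0 _ z hz
  obtain ⟨⟨hb0, hb1⟩, -⟩ := hb
  obtain ⟨ε, hε, hle⟩ := hb1 (fun i => v i)
  have hsup : (⨆ k : Fin (2 * M), ν (v k)) ≤ 1 :=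
    Real.iSup_le (fun k => hT _ (hv k)) zero_le_one
  have hMR : (0 : ℝ) < ((2 * M : ℕ) : ℝ) := by positivity
  have hle2 : ν (∑ k, ε k • v k) ≤ b * ((2 * M : ℕ) : ℝ) :=
    hle.trans (by nlinarith [mul_nonneg hb0 hMR.le])
  rw [Finset.sum_range]
  set A := Finset.univ.filter (fun k : Fin (2 * M) => ε k = 1) with hA
  set B := Finset.univ.filter (fun k : Fin (2 * M) => ¬ ε k = 1) with hB
  have hcard : A.card + B.card = 2 * M := by
    rw [hA, hB, Finset.card_filter_add_card_filter_not]; simp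
  have hsumv : ∑ k : Fin (2 * M), v k = ∑ k ∈ A, v k + ∑ k ∈ B, v k :=
    (Finset.sum_filter_add_sum_filter_not _ _ _).symm
  have hsume : ∑ k : Fin (2 * M), ε k • v k = ∑ k ∈ A, v k - ∑ k ∈ B, v k := by
    rw [← Finset.sum_filter_add_sum_filter_not Finset.univ (fun k : Fin (2 * M) => ε k = 1),
      sub_eq_add_neg, ← Finset.sum_neg_distrib]
    congr 1
    · refine Finset.sum_congr rfl fun k hk => ?_
      rw [(Finset.mem_filter.1 hk).2, one_smul]
    · refine Finset.sum_congr rfl fun k hk => ?_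
      rw [(hε k).resolve_left (Finset.mem_filter.1 hk).2, neg_one_smul]
  rw [hsume] at hle2
  have hM' : (M : ℝ) ≠ 0 := by positivity
  have key : ∀ a c : E, ν (a - c) ≤ b * ((2 * M : ℕ) : ℝ) →
      ν ((1 / ((2 * M : ℕ) : ℝ)) • (a + c) - (1 / (M : ℝ)) • a) ≤ b := by
    intro a c h
    have : (1 / ((2 * M : ℕ) : ℝ)) • (a + c) - (1 / (M : ℝ)) • a
        = (-(1 / ((2 * M : ℕ) : ℝ))) • (a - c) := by
      have : (1 / (M : ℝ)) = 2 * (1 / ((2 * M : ℕ) : ℝ)) := by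
        push_cast; field_simp
      rw [this]; module
    rw [this, hνsmul, abs_neg, abs_of_pos (by positivity), one_div, inv_mul_le_iff₀ hMR]
    linarith
  rcases le_total A.card M with h | h
  · refine ⟨_, QS_subsum h0 A h (fun k => v k) (fun k => hv k), ?_⟩
    rw [hsumv]
    exact key _ _ hle2
  · refine ⟨_, QS_subsum h0 B (by omega) (fun k => v k) (fun k => hv k), ?_⟩
    rw [hsumv, add_comm]
    refine key _ _ ?_
    rw [← hneg, neg_sub]
    exact hle2

lemma multi_halving (ν : E → ℝ) (hνadd : ∀ x y, ν (x + y) ≤ ν x + ν y)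
    (hνsmul : ∀ (a : ℝ) x, ν (a • x) = |a| * ν x) {T : Set E} (h0 : (0 : E) ∈ T)
    (hT : ∀ t ∈ T, ν t ≤ 1) {m : ℕ} (hm : 0 < m) {b : ℕ → ℝ}
    (hb : ∀ N, IsLeastSignBalanceFor ν N (b N)) (K : ℕ) :
    ∀ z ∈ QS T (2 ^ K * m), ∃ w ∈ QS T m,
      ν ((1 / ((2 ^ K * m : ℕ) : ℝ)) • z - (1 / (m : ℝ)) • w) ≤
        ∑ k ∈ Finset.range K, b (2 ^ (k + 1) * m) := by
  have hn0 : ν 0 = 0 := by simpa using hνsmul 0 0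
  induction K with
  | zero =>
    intro z hz
    refine ⟨z, by simpa using hz, ?_⟩
    simp [hn0]
  | succ K ih =>
    intro z hz
    have e : 2 ^ (K + 1) * m = 2 * (2 ^ K * m) := by ring
    rw [e] at hz
    obtain ⟨w, hw, hle⟩ := halving ν hνadd hνsmul h0 hT (M := 2 ^ K * m) (by positivity) (hb _) hz
    obtain ⟨w', hw', hle'⟩ := ih w hw
    refine ⟨w', hw', ?_⟩
    rw [Finset.sum_range_succ, e]
    have := hνadd ((1 / ((2 * (2 ^ K * m) : ℕ) : ℝ)) • z - (1 / ((2 ^ K * m : ℕ) : ℝ)) • w)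
      ((1 / ((2 ^ K * m : ℕ) : ℝ)) • w - (1 / (m : ℝ)) • w')
    rw [sub_add_sub_cancel] at this
    linarith

lemma approx (ν : E → ℝ) (hνadd : ∀ x y, ν (x + y) ≤ ν x + ν y)
    (hνsmul : ∀ (a : ℝ) x, ν (a • x) = |a| * ν x) {T P : Set E} (h0 : (0 : E) ∈ T)
    (hT : ∀ t ∈ T, ν t ≤ 1) (hP : P ⊆ T) {x : E} (hx : x ∈ convexHull ℝ P) :
    ∃ L : ℝ, ∀ N : ℕ, 0 < N → ∃ z ∈ QS T N, ν (x - (1 / (N : ℝ)) • z) ≤ L / N := by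
  rw [convexHull_eq] at hx
  obtain ⟨ι, t, w, p, hw0, hw1, hp, rfl⟩ := hx
  rw [Finset.centerMass_eq_of_sum_1 _ _ hw1]
  refine ⟨t.card, fun N hN => ?_⟩
  have hNR : (0 : ℝ) < N := by exact_mod_cast hN
  refine ⟨∑ i ∈ t, ⌊N * w i⌋₊ • p i, ?_, ?_⟩
  · refine QS_mono h0 ?_ (QS_sum t (fun i => ⌊N * w i⌋₊) _ fun i hi => QS_nsmul (hP (hp i hi)) _)
    have : ((∑ i ∈ t, ⌊N * w i⌋₊ : ℕ) : ℝ) ≤ N := by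
      push_cast
      calc ∑ i ∈ t, (⌊N * w i⌋₊ : ℝ) ≤ ∑ i ∈ t, N * w i :=
            Finset.sum_le_sum fun i hi => Nat.floor_le (mul_nonneg hNR.le (hw0 i hi))
        _ = N := by rw [← Finset.mul_sum, hw1, mul_one]
    exact_mod_cast this
  · rw [Finset.smul_sum, ← Finset.sum_sub_distrib]
    refine (nu_sum ν hνadd hνsmul _ _).trans ?_
    calc ∑ i ∈ t, ν (w i • p i - (1 / (N : ℝ)) • ⌊N * w i⌋₊ • p i) ≤ ∑ i ∈ t, 1 / (N : ℝ) := by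
          refine Finset.sum_le_sum fun i hi => ?_
          have e : w i • p i - (1 / (N : ℝ)) • ⌊N * w i⌋₊ • p i
              = ((1 / (N : ℝ)) * (N * w i - ⌊N * w i⌋₊)) • p i := by
            rw [← Nat.cast_smul_eq_nsmul ℝ, smul_smul, ← sub_smul]
            congr 1
            field_simp
          have h1 : 0 ≤ N * w i - ⌊N * w i⌋₊ :=
            sub_nonneg.2 (Nat.floor_le (mul_nonneg hNR.le (hw0 i hi)))
          have h2 : N * w i - ⌊N * w i⌋₊ ≤ 1 := by
            linarith [Nat.lt_floor_add_one (N * w i)]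
          have h3 := hT _ (hP (hp i hi))
          have h4 := nu_nonneg ν hνadd hνsmul (p i)
          have h5 : 0 < 1 / (N : ℝ) := by positivity
          rw [e, hνsmul, abs_of_nonneg (mul_nonneg h5.le h1), mul_assoc]
          nlinarith [mul_le_one₀ h2 h4 h3]
      _ = t.card / (N : ℝ) := by simp [div_eq_mul_inv]

lemma one_step [FiniteDimensional ℝ E] (ν : E → ℝ) (hνadd : ∀ x y, ν (x + y) ≤ ν x + ν y)
    (hνsmul : ∀ (a : ℝ) x, ν (a • x) = |a| * ν x) {T P : Set E} (h0 : (0 : E) ∈ T)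
    (hTc : IsCompact T)
    (hT : ∀ t ∈ T, ν t ≤ 1) (hP : P ⊆ T) {m : ℕ} (hm : 0 < m) {b : ℕ → ℝ}
    (hb : ∀ N, IsLeastSignBalanceFor ν N (b N)) {θ : ℝ}
    (hsummable : Summable (fun k : ℕ => b (2 ^ (k + 1) * m)))
    (hsum : ∑' k : ℕ, b (2 ^ (k + 1) * m) ≤ θ) {x : E} (hx : x ∈ convexHull ℝ P) :
    ∃ w ∈ QS T m, ν (x - (1 / (m : ℝ)) • w) ≤ θ := by
  have hνc : Continuous ν := by
    have : ConvexOn ℝ Set.univ ν := by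
      refine ⟨convex_univ, fun x _ y _ a c ha hc _ => (hνadd _ _).trans ?_⟩
      rw [hνsmul, hνsmul, abs_of_nonneg ha, abs_of_nonneg hc, smul_eq_mul, smul_eq_mul]
    exact this.locallyLipschitz.continuous
  obtain ⟨w, hw, hmin⟩ := (QS_compact hTc m).exists_isMinOn
    ⟨0, QS_mono h0 (Nat.zero_le m) rfl⟩
    (f := fun w => ν (x - (1 / (m : ℝ)) • w)) (by fun_prop)
  refine ⟨w, hw, ?_⟩
  obtain ⟨L, hL⟩ := approx ν hνadd hνsmul h0 hT hP hx
  have hbound : ∀ K : ℕ, ν (x - (1 / (m : ℝ)) • w) ≤ L / ((2 ^ K * m : ℕ) : ℝ) + θ := by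
    intro K
    obtain ⟨z, hz, hzle⟩ := hL (2 ^ K * m) (by positivity)
    obtain ⟨w', hw', hle⟩ := multi_halving ν hνadd hνsmul h0 hT hm hb K z hz
    have h1 : ν (x - (1 / (m : ℝ)) • w) ≤ ν (x - (1 / (m : ℝ)) • w') := hmin hw'
    have h2 := hνadd (x - (1 / ((2 ^ K * m : ℕ) : ℝ)) • z)
      ((1 / ((2 ^ K * m : ℕ) : ℝ)) • z - (1 / (m : ℝ)) • w')
    rw [sub_add_sub_cancel] at h2
    have h3 := hsummable.sum_le_tsum (Finset.range K) (fun k _ => (hb _).1.1)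
    linarith
  have hlim : Tendsto (fun K : ℕ => L / ((2 ^ K * m : ℕ) : ℝ) + θ) atTop (𝓝 (0 + θ)) := by
    refine Tendsto.add_const _ ?_
    refine Tendsto.div_atTop tendsto_const_nhds ?_
    refine tendsto_natCast_atTop_atTop.comp ?_
    exact (tendsto_pow_atTop_atTop_of_one_lt (by norm_num : 1 < 2)).atTop_mul_const' hm
  rw [zero_add] at hlim
  exact ge_of_tendsto' hlim hbound

end

lemma const_ineq {θ : ℝ} (h0 : 1 / 3 < θ) (h1 : θ < 1) {m : ℕ} (hm : 0 < m) :
    θ ^ (1 / (m : ℝ)) ≤ m * (2 * θ / ((3 * θ - 1) * (1 - θ))) * (1 - θ ^ (1 / (m : ℝ))) * θ := by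
  have hθ : 0 < θ := by linarith
  have hmR : (0 : ℝ) < m := by exact_mod_cast hm
  set φ := θ ^ (1 / (m : ℝ)) with hφ
  have hφ0 : 0 < φ := Real.rpow_pos_of_pos hθ _
  have hlogφ : Real.log φ = (1 / m) * Real.log θ := Real.log_rpow hθ _
  have hlog : (1 - θ) + (1 - θ) ^ 2 / 2 ≤ - Real.log θ := by
    have := Real.hasSum_pow_div_log_of_abs_lt_one (x := 1 - θ) (by rw [abs_lt]; constructor <;> linarith)
    have h := sum_le_hasSum (Finset.range 2) (fun i _ => by
      have : 0 < 1 - θ := by linarith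
      positivity) this
    simp [Finset.sum_range_succ] at h
    norm_num at h
    linarith
  -- `1/φ - 1 ≥ -log φ`
  have h2 : φ * (-Real.log θ) ≤ m * (1 - φ) := by
    have := Real.one_sub_inv_le_log_of_pos (inv_pos.2 hφ0)
    have h3 := Real.log_le_sub_one_of_pos (inv_pos.2 hφ0)
    rw [Real.log_inv, hlogφ] at h3
    have h4 := mul_le_mul_of_nonneg_left h3 (mul_pos hmR hφ0).le
    have e1 : m * φ * (-(1 / m * Real.log θ)) = φ * (-Real.log θ) := by field_simp
    have e2 : m * φ * (φ⁻¹ - 1) = m * (1 - φ) := by field_simp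
    linarith
  have hD : 0 < (3 * θ - 1) * (1 - θ) := mul_pos (by linarith) (by linarith)
  have h5 : (3 * θ - 1) * (1 - θ) ≤ 2 * θ * θ * (-Real.log θ) := by
    have h6 : 2 * θ * θ * ((1 - θ) + (1 - θ) ^ 2 / 2) ≤ 2 * θ * θ * (-Real.log θ) :=
      mul_le_mul_of_nonneg_left hlog (by positivity)
    have h7 : 0 ≤ (1 - θ) ^ 4 := by positivity
    nlinarith
  have e : m * (2 * θ / ((3 * θ - 1) * (1 - θ))) * (1 - φ) * θ
      = (2 * θ * θ * (m * (1 - φ))) / ((3 * θ - 1) * (1 - θ)) := by ring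
  rw [e, le_div_iff₀ hD]
  calc φ * ((3 * θ - 1) * (1 - θ)) ≤ φ * (2 * θ * θ * (-Real.log θ)) :=
        mul_le_mul_of_nonneg_left h5 hφ0.le
    _ = 2 * θ * θ * (φ * (-Real.log θ)) := by ring
    _ ≤ _ := mul_le_mul_of_nonneg_left h2 (by positivity)

theorem stmt_10 (n : ℕ) (S : Set (EuclideanSpace ℝ (Fin n)))
    (hScpt : IsCompact S) (hSspan : Submodule.span ℝ S = ⊤)
    (ν : EuclideanSpace ℝ (Fin n) → ℝ)
    (hν0 : ∀ x, ν x = 0 → x = 0)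
    (hνadd : ∀ x y, ν (x + y) ≤ ν x + ν y)
    (hνsmul : ∀ (a : ℝ) x, ν (a • x) = |a| * ν x)
    (hball : {x | ν x ≤ 1} = convexHull ℝ (S ∪ -S))
    (b : ℕ → ℝ) (hb : ∀ N, IsLeastSignBalanceFor ν N (b N))
    (θ : ℝ) (hθ0 : 1 / 3 < θ) (hθ1 : θ < 1) (m : ℕ) (hm : 0 < m)
    (hsummable : Summable (fun k : ℕ => b (2 ^ (k + 1) * m)))
    (hsum : ∑' k : ℕ, b (2 ^ (k + 1) * m) ≤ θ) :
    convexHull ℝ (S ∪ -S) ⊆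
      (2 * θ / ((3 * θ - 1) * (1 - θ))) • geomHull (θ ^ (1 / (m : ℝ))) S := by
  have hn0 : ν 0 = 0 := by simpa using hνsmul 0 0
  have hθ : 0 < θ := by linarith
  have hmR : (0 : ℝ) < m := by exact_mod_cast hm
  have hSne : S.Nonempty := by
    by_contra h
    rw [Set.not_nonempty_iff_eq_empty] at h
    have : (0 : EuclideanSpace ℝ (Fin n)) ∈ {x | ν x ≤ 1} := by simp [hn0]
    rw [hball, h] at this
    simp at this
  have hball' : ∀ x, ν x ≤ 1 ↔ x ∈ convexHull ℝ (S ∪ -S) := fun x => by rw [← hball]; rfl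
  set T : Set (EuclideanSpace ℝ (Fin n)) :=
    (fun q : ℝ × EuclideanSpace ℝ (Fin n) => q.1 • q.2) '' (Set.Icc (-1) 1 ×ˢ S) with hTdef
  have hTc : IsCompact T := (isCompact_Icc.prod hScpt).image (by fun_prop)
  obtain ⟨s₀, hs₀⟩ := hSne
  have hT0 : (0 : EuclideanSpace ℝ (Fin n)) ∈ T :=
    ⟨(0, s₀), ⟨by simp, hs₀⟩, by simp⟩
  have hTν : ∀ t ∈ T, ν t ≤ 1 := by
    rintro _ ⟨⟨a, s⟩, ⟨ha, hs⟩, rfl⟩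
    have h1 : ν s ≤ 1 := (hball' s).2 (subset_convexHull ℝ _ (Or.inl hs))
    have h2 := nu_nonneg ν hνadd hνsmul s
    have h3 : |a| ≤ 1 := abs_le.2 ha
    simp only [hνsmul]
    exact mul_le_one₀ h3 h2 h1
  have hP : S ∪ -S ⊆ T := by
    rintro s (hs | hs)
    · exact ⟨(1, s), ⟨by simp, hs⟩, by simp⟩
    · exact ⟨(-1, -s), ⟨by simp, hs⟩, by simp⟩
  have step : ∀ x : EuclideanSpace ℝ (Fin n), ∃ (l : ℕ → ℝ) (s : ℕ → EuclideanSpace ℝ (Fin n)),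
      (∀ i, |l i| ≤ 1) ∧ (∀ i, s i ∈ S) ∧ (x ∈ convexHull ℝ (S ∪ -S) →
        ν (x - (1 / (m : ℝ)) • ∑ i ∈ Finset.range m, l i • s i) ≤ θ) := by
    intro x
    by_cases hx : x ∈ convexHull ℝ (S ∪ -S)
    · obtain ⟨w, hw, hle⟩ := one_step ν hνadd hνsmul hT0 hTc hTν hP hm hb hsummable hsum hx
      obtain ⟨v, hv, rfl⟩ := QS_exists hT0 m w hw
      choose q hq hqe using hv
      refine ⟨fun i => (q i).1, fun i => (q i).2, fun i => abs_le.2 (hq i).1,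
        fun i => (hq i).2, fun _ => ?_⟩
      simpa only [hqe] using hle
    · exact ⟨fun _ => 0, fun _ => s₀, by simp, fun _ => hs₀, fun h => absurd h hx⟩
  choose l s hl hs hstep using step
  intro x hx
  set y : EuclideanSpace ℝ (Fin n) → EuclideanSpace ℝ (Fin n) :=
    fun x => (1 / (m : ℝ)) • ∑ i ∈ Finset.range m, l x i • s x i with hy
  let X : ℕ → EuclideanSpace ℝ (Fin n) := fun j => Nat.rec x (fun _ p => θ⁻¹ • (p - y p)) j
  have hX0 : X 0 = x := rfl
  have hXs : ∀ j, X (j + 1) = θ⁻¹ • (X j - y (X j)) := fun j => rfl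
  have hXmem : ∀ j, X j ∈ convexHull ℝ (S ∪ -S) := by
    intro j
    induction j with
    | zero => exact hx
    | succ j ih =>
      rw [hXs, ← hball', hνsmul, abs_of_pos (inv_pos.2 hθ), inv_mul_le_iff₀ hθ, mul_one]
      exact hstep _ ih
  have hc := const_ineq hθ0 hθ1 hm
  set C := 2 * θ / ((3 * θ - 1) * (1 - θ)) with hC
  set φ := θ ^ (1 / (m : ℝ)) with hφ
  have hφ0 : 0 < φ := Real.rpow_pos_of_pos hθ _
  have hφ1 : φ < 1 := Real.rpow_lt_one hθ.le hθ1 (by positivity)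
  have hφm : φ ^ m = θ := by
    rw [hφ, ← Real.rpow_natCast, ← Real.rpow_mul hθ.le, one_div, inv_mul_cancel₀ hmR.ne',
      Real.rpow_one]
  have hCpos : 0 < C := div_pos (by linarith) (mul_pos (by linarith) (by linarith))
  have h1φ : 0 < 1 - φ := by linarith
  set c : ℕ → ℝ := fun k => l (X (k / m)) (k % m) * (θ ^ (k / m) / (m * C * (1 - φ))) with hcdef
  set p : ℕ → EuclideanSpace ℝ (Fin n) := fun k => s (X (k / m)) (k % m) with hpdef
  have hcb : ∀ k, |c k| ≤ φ ^ k := by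
    intro k
    have hD : 0 < m * C * (1 - φ) := by positivity
    have e1 : φ ^ k = θ ^ (k / m) * φ ^ (k % m) := by
      conv_lhs => rw [← Nat.div_add_mod k m]
      rw [pow_add, pow_mul, hφm]
    have e2 : θ / φ ≤ φ ^ (k % m) := by
      rw [div_le_iff₀ hφ0, ← pow_succ, ← hφm]
      exact pow_le_pow_of_le_one hφ0.le hφ1.le (Nat.mod_lt k hm)
    have e3 : 1 / (m * C * (1 - φ)) ≤ θ / φ := by
      rw [div_le_div_iff₀ hD hφ0]
      linarith
    rw [hcdef, abs_mul, abs_of_pos (a := θ ^ (k / m) / (m * C * (1 - φ))) (by positivity), e1]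
    calc _ ≤ 1 * (θ ^ (k / m) / (m * C * (1 - φ))) :=
          mul_le_mul_of_nonneg_right (hl _ _) (by positivity)
      _ = θ ^ (k / m) * (1 / (m * C * (1 - φ))) := by ring
      _ ≤ _ := mul_le_mul_of_nonneg_left (e3.trans e2) (by positivity)
  obtain ⟨R, hR⟩ := hScpt.isBounded.exists_norm_le
  have hsm : Summable (fun k => ((1 - φ) * c k) • p k) := by
    refine Summable.of_norm_bounded (g := fun k => (1 - φ) * R * φ ^ k)
      ((summable_geometric_of_lt_one hφ0.le hφ1).mul_left _) fun k => ?_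
    rw [norm_smul, norm_mul, Real.norm_eq_abs, Real.norm_eq_abs, abs_of_pos h1φ]
    have h1 := hcb k
    have h2 := hR _ (hs (X (k / m)) (k % m))
    calc (1 - φ) * |c k| * ‖p k‖ ≤ (1 - φ) * φ ^ k * R := by gcongr
      _ = _ := by ring
  have hpart : ∀ J : ℕ, ∑ k ∈ Finset.range (J * m), ((1 - φ) * c k) • p k
      = C⁻¹ • (x - θ ^ J • X J) := by
    intro J
    induction J with
    | zero => simp [hX0]
    | succ J ih =>
      have hblock : ∑ i ∈ Finset.range m, ((1 - φ) * c (J * m + i)) • p (J * m + i)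
          = (C⁻¹ * θ ^ J) • y (X J) := by
        rw [hy]
        simp only []
        rw [smul_smul, Finset.smul_sum]
        refine Finset.sum_congr rfl fun i hi => ?_
        have him := Finset.mem_range.1 hi
        have d1 : (J * m + i) / m = J := by
          rw [mul_comm, Nat.mul_add_div hm, Nat.div_eq_of_lt him, add_zero]
        have d2 : (J * m + i) % m = i := by
          rw [mul_comm, Nat.mul_add_mod, Nat.mod_eq_of_lt him]
        simp only [hcdef, hpdef, d1, d2, smul_smul]
        congr 1
        field_simp
      rw [Nat.succ_mul, Finset.sum_range_add, ih, hblock, hXs]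
      have e : θ ^ (J + 1) • θ⁻¹ • (X J - y (X J)) = θ ^ J • (X J - y (X J)) := by
        rw [smul_smul, pow_succ, mul_assoc, mul_inv_cancel₀ hθ.ne', mul_one]
      rw [e]
      module
  have hconv : Tendsto (fun J : ℕ => C⁻¹ • (x - θ ^ J • X J)) atTop (𝓝 (C⁻¹ • (x - 0))) := by
    refine Tendsto.const_smul (Tendsto.const_sub _ ?_) _
    obtain ⟨R', hR'⟩ := (isBounded_convexHull.2
      (hScpt.isBounded.union hScpt.neg.isBounded)).exists_norm_le
    refine squeeze_zero_norm (a := fun J => θ ^ J * R') (fun J => ?_) ?_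
    · rw [norm_smul, norm_pow, Real.norm_eq_abs, abs_of_pos hθ]
      exact mul_le_mul_of_nonneg_left (hR' _ (hXmem J)) (by positivity)
    · simpa using (tendsto_pow_atTop_nhds_zero_of_lt_one hθ.le hθ1).mul_const R'
  have hlim := hsm.hasSum.tendsto_sum_nat.comp
    (tendsto_id.atTop_mul_const' hm : Tendsto (fun J : ℕ => J * m) atTop atTop)
  have heq : ∑' k, ((1 - φ) * c k) • p k = C⁻¹ • x := by
    refine tendsto_nhds_unique hlim ?_
    rw [sub_zero] at hconv
    exact hconv.congr fun J => (hpart J).symm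
  refine ⟨C⁻¹ • x, ⟨c, p, hcb, fun k => hs _ _, heq ▸ hsm.hasSum⟩, ?_⟩
  exact smul_inv_smul₀ hCpos.ne' x
end
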